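/- Given a chain T ⊆ F, there exists a map φ : T_* ∩ F → F such that: (1) for all A ∈ T_* ∩ F, φ(A) △ A ∈ N; (2) for all A, B ∈ T_* ∩ F, φ(A) = φ(B) if and only if A △ B ∈ N, and φ(A) ⊊ φ(B) if and only if (A ∖ B ∈ N and A △ B ∉ N); (3) for every nonempty S ⊆ T_* ∩ F, ⋃{φ(A) : A ∈ S} ∈ F with ν(⋃{φ(A) : A ∈ S}) = sup{ν(φ(A)) : A ∈ S}, and ⋂{φ(A) : A ∈ S} ∈ F with ν(⋂{φ(A) : A ∈ S}) = inf{ν(φ(A)) : A ∈ S}; (4) every set A in the closure of φ(T_* ∩ F) under arbitrary unions and intersections lies in F and satisfies ν_N(A) ≤ ν(A) for all N ∈ ℕ; (5) if ρ : T_* ∩ F → F is any map with ρ(A) △ A ∈ N for all A ∈ T_* ∩ F, then for every nonempty S ⊆ T_* ∩ F: if ⋃{ρ(A) : A ∈ S} ∈ F with ν(⋃{ρ(A) : A ∈ S}) = sup{ν(ρ(A)) : A ∈ S}, then (⋃{φ(A) : A ∈ S}) △ (⋃{ρ(A) : A ∈ S}) ∈ N, and if ⋂{ρ(A) : A ∈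 S} ∈ F with ν(⋂{ρ(A) : A ∈ S}) = inf{ν(ρ(A)) : A ∈ S}, then (⋂{φ(A) : A ∈ S}) △ (⋂{ρ(A) : A ∈ S}) ∈ N. -/

import Mathlib

/-- The partial average `ν_N(A) = (1/N)·∑_{n=1}^N 1_A(n)`. -/
noncomputable def nuN (A : Set ℕ) (N : ℕ) : ℝ :=
  (∑ n ∈ Finset.Icc 1 N, A.indicator (fun _ => (1 : ℝ)) n) / N

/-- The upper Cesàro limit `ν⁺(A)`. -/
noncomputable def nuPlus (A : Set ℕ) : ℝ :=
  Filter.limsup (fun N => nuN A N) Filter.atTop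

/-- The lower Cesàro limit `ν⁻(A)`. -/
noncomputable def nuMinus (A : Set ℕ) : ℝ :=
  Filter.liminf (fun N => nuN A N) Filter.atTop

/-- `A ∈ F`: the Cesàro limit of `A` exists. -/
def memF (A : Set ℕ) : Prop :=
  ∃ l : ℝ, Filter.Tendsto (fun N => nuN A N) Filter.atTop (nhds l)

/-- The Cesàro limit `ν(A)`; it coincides with `ν⁺(A)` whenever `A ∈ F`. -/
noncomputable def nu (A : Set ℕ) : ℝ := nuPlus A

/-- `A ∈ N`: `A` is a null set. -/
def nullSet (A : Set ℕ) : Prop := memF A ∧ nu A = 0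
/-- `T_∪`: closure of `T` under arbitrary unions. -/
def unionClosure (T : Set (Set ℕ)) : Set (Set ℕ) := {B | ∃ C ⊆ T, B = ⋃₀ C}

/-- `T_∩`: closure of `T` under arbitrary intersections. -/
def interClosure (T : Set (Set ℕ)) : Set (Set ℕ) := {B | ∃ C ⊆ T, B = ⋂₀ C}

/-- `T_* = T_∪ ∪ T_∩`. -/
def starClosure (T : Set (Set ℕ)) : Set (Set ℕ) := unionClosure T ∪ interClosure T

open Filter Topology Set

/-- The number of elements of the finite set `P` lying in `X`. -/
noncomputable def countIn (X : Set ℕ) (P : Finset ℕ) : ℕ := by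
  classical exact (P.filter (· ∈ X)).card

/-- `X` has natural density `d`. -/
def HasDensity (X : Set ℕ) (d : ℝ) : Prop := Tendsto (fun N => nuN X N) atTop (𝓝 d)

section countIn

variable {X Y : Set ℕ} {P Q : Finset ℕ}

lemma countIn_le_card : countIn X P ≤ P.card := by
  classical exact Finset.card_filter_le _ _

lemma countIn_mono (h : ∀ n ∈ P, n ∈ X → n ∈ Y) : countIn X P ≤ countIn Y P := by
  classical
  refine Finset.card_le_card fun n hn => ?_
  simp only [Finset.mem_filter] at hn ⊢
  exact ⟨hn.1, h n hn.1 hn.2⟩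

lemma countIn_mono_right (h : P ⊆ Q) : countIn X P ≤ countIn X Q := by
  classical exact Finset.card_le_card (Finset.filter_subset_filter _ h)

lemma countIn_Ioc_add {a b c : ℕ} (hab : a ≤ b) (hbc : b ≤ c) :
    countIn X (Finset.Ioc a b) + countIn X (Finset.Ioc b c) = countIn X (Finset.Ioc a c) := by
  classical
  unfold countIn
  rw [← Finset.Ioc_union_Ioc_eq_Ioc hab hbc, Finset.filter_union, Finset.card_union_of_disjoint]
  refine Finset.disjoint_left.2 fun n hn hm => ?_
  simp only [Finset.mem_filter, Finset.mem_Ioc] at hn hm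
  omega

lemma countIn_union_le : countIn (X ∪ Y) P ≤ countIn X P + countIn Y P := by
  classical
  unfold countIn
  refine (Finset.card_le_card fun n hn => ?_).trans (Finset.card_union_le _ _)
  simp only [Finset.mem_filter, Finset.mem_union, Set.mem_union] at hn ⊢
  tauto

lemma countIn_sdiff_add (h : ∀ n ∈ P, n ∈ X → n ∈ Y) :
    countIn (Y \ X) P + countIn X P = countIn Y P := by
  classical
  unfold countIn
  rw [← Finset.card_union_of_disjoint]
  · congr 1
    ext n
    simp only [Finset.mem_filter, Finset.mem_union, Set.mem_sdiff]
    have := h n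
    tauto
  · refine Finset.disjoint_left.2 fun n hn hm => ?_
    simp only [Finset.mem_filter, Set.mem_sdiff] at hn hm
    tauto

lemma countIn_symmDiff_of_forall (h : ∀ n ∈ P, n ∈ X → n ∈ Y) :
    (countIn (symmDiff X Y) P : ℝ) = |(countIn X P : ℝ) - countIn Y P| := by
  have h1 : countIn (symmDiff X Y) P = countIn (Y \ X) P := by
    apply le_antisymm <;> refine countIn_mono fun n hn hx => ?_
    · rcases hx with hx | hx
      · exact absurd (h n hn hx.1) hx.2
      · exact hx
    · exact Or.inr hx
  have h2 : (countIn (Y \ X) P : ℝ) + countIn X P = countIn Y P := by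
    exact_mod_cast countIn_sdiff_add h
  rw [h1, ← h2, abs_sub_comm, add_sub_cancel_right, abs_of_nonneg (by positivity)]

/-- On a finite set where `X` and `Y` are comparable, the symmetric difference is counted by the
difference of the counts. -/
lemma countIn_symmDiff (h : (∀ n ∈ P, n ∈ X → n ∈ Y) ∨ ∀ n ∈ P, n ∈ Y → n ∈ X) :
    (countIn (symmDiff X Y) P : ℝ) = |(countIn X P : ℝ) - countIn Y P| := by
  rcases h with h | h
  · exact countIn_symmDiff_of_forall h
  · rw [symmDiff_comm, abs_sub_comm]
    exact countIn_symmDiff_of_forall h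

lemma nuN_eq_countIn (X : Set ℕ) (N : ℕ) : nuN X N = countIn X (Finset.Ioc 0 N) / N := by
  classical
  unfold nuN countIn
  rw [Finset.card_filter]
  push_cast
  rfl

lemma countIn_eq_nuN_mul (X : Set ℕ) (N : ℕ) : (countIn X (Finset.Ioc 0 N) : ℝ) = nuN X N * N := by
  rw [nuN_eq_countIn]
  rcases eq_or_ne N 0 with rfl | h
  · simp [countIn]
  · field_simp

end countIn

section density

variable {A B X Y : Set ℕ} {d e : ℝ}

lemma nuN_nonneg (X : Set ℕ) (N : ℕ) : 0 ≤ nuN X N := by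
  rw [nuN_eq_countIn]; positivity

lemma nuN_le_one (X : Set ℕ) (N : ℕ) : nuN X N ≤ 1 := by
  rw [nuN_eq_countIn]
  refine div_le_one_of_le₀ ?_ (by positivity)
  have := countIn_le_card (X := X) (P := Finset.Ioc 0 N)
  simp only [Nat.card_Ioc] at this
  exact_mod_cast this

lemma nuN_mono (h : X ⊆ Y) (N : ℕ) : nuN X N ≤ nuN Y N := by
  simp only [nuN_eq_countIn]
  have : countIn X (Finset.Ioc 0 N) ≤ countIn Y (Finset.Ioc 0 N) := countIn_mono fun n _ hn => h hn
  gcongr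

lemma nuN_union_le (X Y : Set ℕ) (N : ℕ) : nuN (X ∪ Y) N ≤ nuN X N + nuN Y N := by
  simp only [nuN_eq_countIn]
  rw [← add_div]
  have : (countIn (X ∪ Y) (Finset.Ioc 0 N) : ℝ) ≤
      countIn X (Finset.Ioc 0 N) + countIn Y (Finset.Ioc 0 N) := by
    exact_mod_cast countIn_union_le
  gcongr

lemma nuN_sdiff (h : X ⊆ Y) (N : ℕ) : nuN (Y \ X) N = nuN Y N - nuN X N := by
  simp only [nuN_eq_countIn]
  rw [← sub_div]
  have : (countIn (Y \ X) (Finset.Ioc 0 N) : ℝ) + countIn X (Finset.Ioc 0 N) =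
      countIn Y (Finset.Ioc 0 N) := by
    exact_mod_cast countIn_sdiff_add fun n _ hn => h hn
  rw [← this, add_sub_cancel_right]

namespace HasDensity

lemma memF (h : HasDensity A d) : memF A := ⟨d, h⟩

lemma nu_eq (h : HasDensity A d) : nu A = d := h.limsup_eq

lemma nonneg (h : HasDensity A d) : 0 ≤ d := ge_of_tendsto' h fun N => nuN_nonneg A N

lemma le_one (h : HasDensity A d) : d ≤ 1 := le_of_tendsto' h fun N => nuN_le_one A N

lemma mono (h : HasDensity A d) (h' : HasDensity B e) (hAB : A ⊆ B) : d ≤ e :=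
  le_of_tendsto_of_tendsto' h h' fun N => nuN_mono hAB N

lemma sdiff (h : HasDensity A d) (h' : HasDensity B e) (hAB : A ⊆ B) :
    HasDensity (B \ A) (e - d) :=
  (Tendsto.sub h' h).congr fun N => (nuN_sdiff hAB N).symm

lemma zero_of_subset (h : HasDensity B 0) (hAB : A ⊆ B) : HasDensity A 0 :=
  squeeze_zero (fun N => nuN_nonneg A N) (fun N => nuN_mono hAB N) h

lemma zero_union (h : HasDensity A 0) (h' : HasDensity B 0) : HasDensity (A ∪ B) 0 :=
  squeeze_zero (fun N => nuN_nonneg _ N) (fun N => nuN_union_le A B N)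
    (by simpa using Tendsto.add h h')

/-- Transitivity of equality up to a null set. -/
lemma zero_symmDiff_trans {C : Set ℕ} (h : HasDensity (symmDiff A B) 0)
    (h' : HasDensity (symmDiff B C) 0) : HasDensity (symmDiff A C) 0 :=
  (h.zero_union h').zero_of_subset (symmDiff_triangle A B C)

/-- Density is invariant under changes by a null set. -/
lemma congr_symmDiff (h : HasDensity A d) (h' : HasDensity (symmDiff A B) 0) : HasDensity B d := by
  have key : ∀ X Y : Set ℕ, ∀ N, nuN X N ≤ nuN Y N + nuN (symmDiff X Y) N := fun X Y N =>
    (nuN_mono (fun n hn => by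
      by_cases hY : n ∈ Y
      · exact Or.inl hY
      · exact Or.inr (Or.inl ⟨hn, hY⟩)) N).trans (nuN_union_le _ _ N)
  refine tendsto_of_tendsto_of_tendsto_of_le_of_le (g := fun N => nuN A N - nuN (symmDiff A B) N)
    (h := fun N => nuN A N + nuN (symmDiff A B) N) (by simpa using Tendsto.sub h h')
    (by simpa using Tendsto.add h h') (fun N => ?_) (fun N => ?_)
  · have := key A B N
    simp only
    linarith
  · have := key B A N
    rw [symmDiff_comm] at this
    exact this

end HasDensity

lemma memF.hasDensity (h : memF A) : HasDensity A (nu A) := by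
  obtain ⟨l, hl⟩ := h
  have := HasDensity.nu_eq hl
  rw [this]
  exact hl

lemma nullSet_iff : nullSet A ↔ HasDensity A 0 :=
  ⟨fun h => h.2 ▸ h.1.hasDensity, fun h => ⟨h.memF, h.nu_eq⟩⟩

lemma HasDensity.symmDiff_of_subset {A B : Set ℕ} {d e : ℝ} (h : HasDensity A d)
    (h' : HasDensity B e) (hAB : A ⊆ B) : HasDensity (symmDiff A B) (e - d) := by
  have := h.sdiff h' hAB
  rwa [Set.symmDiff_def, Set.sdiff_eq_empty.2 hAB, Set.empty_union]

/-- Comparable sets of the same density agree up to a null set. -/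
lemma HasDensity.zero_symmDiff_of_subset (h : HasDensity A d) (h' : HasDensity B d) (hAB : A ⊆ B) :
    HasDensity (symmDiff A B) 0 := by
  simpa using h.symmDiff_of_subset h' hAB

end density

lemma sum_countIn_blocks {S : ℕ → ℕ} (hS : StrictMono S) (h0 : S 0 = 0) (X : Set ℕ) (n : ℕ) :
    ∑ j ∈ Finset.range n, (countIn X (Finset.Ioc (S j) (S (j + 1))) : ℝ) =
      countIn X (Finset.Ioc 0 (S n)) := by
  induction n with
  | zero => simp [h0, countIn]
  | succ n ih =>
    rw [Finset.sum_range_succ, ih,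
      ← countIn_Ioc_add (Nat.zero_le (S n)) (hS.monotone (Nat.le_succ n))]
    push_cast; rfl

lemma StrictMono.exists_le_lt_succ {S : ℕ → ℕ} (hS : StrictMono S) {K N : ℕ} (hN : S K ≤ N) :
    ∃ k ≥ K, S k ≤ N ∧ N < S (k + 1) := by
  have hb : ∀ m, S m ≤ N → m ≤ N := fun m hm => (hS.id_le m).trans hm
  refine ⟨Nat.findGreatest (fun m => S m ≤ N) N, Nat.le_findGreatest (hb K hN) hN,
    Nat.findGreatest_spec (P := fun m => S m ≤ N) (hb K hN) hN, ?_⟩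
  by_contra! h
  have := Nat.le_findGreatest (P := fun m => S m ≤ N) (hb _ h) h
  omega

/-- A set with density `x` along consecutive blocks of relatively negligible length has
density `x`. -/
lemma hasDensity_of_blocks {S : ℕ → ℕ} (hS : StrictMono S) (h0 : S 0 = 0)
    (hL : Tendsto (fun j => ((S (j + 1) : ℝ) - S j) / S j) atTop (𝓝 0)) {X : Set ℕ} {x : ℝ}
    (hx : Tendsto (fun j => (countIn X (Finset.Ioc (S j) (S (j + 1))) : ℝ) /
      ((S (j + 1) : ℝ) - S j)) atTop (𝓝 x)) : HasDensity X x := by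
  have hpos : ∀ j, (0 : ℝ) < (S (j + 1) : ℝ) - S j := fun j => by
    have : (S j : ℝ) < S (j + 1) := by exact_mod_cast hS (Nat.lt_succ_self j)
    linarith
  have hsumL : ∀ n, ∑ j ∈ Finset.range n, ((S (j + 1) : ℝ) - S j) = S n := fun n => by
    rw [Finset.sum_range_sub (fun j => (S j : ℝ)), h0]; simp
  have hsumC := sum_countIn_blocks hS h0 X
  have hSr : Tendsto (fun n => (S n : ℝ)) atTop atTop :=
    tendsto_natCast_atTop_atTop.comp hS.tendsto_atTop
  have ho : (fun j => (countIn X (Finset.Ioc (S j) (S (j + 1))) : ℝ) -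
      x * ((S (j + 1) : ℝ) - S j)) =o[atTop] fun j => (S (j + 1) : ℝ) - S j := by
    refine (Asymptotics.isLittleO_iff_tendsto fun j hj => absurd hj (hpos j).ne').2 ?_
    have := hx.sub_const x
    rw [sub_self] at this
    refine this.congr fun j => ?_
    have := (hpos j).ne'
    field_simp
  have hsum := ho.sum_range (fun j => (hpos j).le) (by simpa only [hsumL] using hSr)
  simp only [Finset.sum_sub_distrib, ← Finset.mul_sum, hsumC, hsumL] at hsum
  have hsum' := Asymptotics.isLittleO_iff.1 hsum
  refine Metric.tendsto_atTop.2 fun ε hε => ?_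
  have hx1 : 0 < 1 + |x| := by positivity
  obtain ⟨K, hK⟩ := eventually_atTop.1 ((hsum' (half_pos (half_pos hε))).and
    ((hL.eventually_lt_const (show 0 < ε / 2 / (1 + |x|) by positivity)).and
      (eventually_gt_atTop 0)))
  refine ⟨S K, fun N hN => ?_⟩
  obtain ⟨k, hkK, hk1, hk2⟩ := hS.exists_le_lt_succ hN
  obtain ⟨h1, h2, h3⟩ := hK k hkK
  have hSk : (0 : ℝ) < S k := by
    have : S 0 < S k := hS h3
    rw [h0] at this; exact_mod_cast this
  rw [div_lt_iff₀ hSk] at h2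
  rw [Real.norm_eq_abs, Real.norm_of_nonneg hSk.le] at h1
  have hNk : (S k : ℝ) ≤ N := by exact_mod_cast hk1
  have hNk' : (N : ℝ) < S (k + 1) := by exact_mod_cast hk2
  have hc := countIn_Ioc_add (X := X) (Nat.zero_le (S k)) hk1
  have hcb : (countIn X (Finset.Ioc (S k) N) : ℝ) ≤ N - S k := by
    have := countIn_le_card (X := X) (P := Finset.Ioc (S k) N)
    rw [Nat.card_Ioc] at this
    rw [← Nat.cast_sub hk1]
    exact_mod_cast this
  have hcr : (countIn X (Finset.Ioc 0 (S k)) : ℝ) + countIn X (Finset.Ioc (S k) N) =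
      countIn X (Finset.Ioc 0 N) := by exact_mod_cast hc
  have hNpos : (0 : ℝ) < N := hSk.trans_le hNk
  rw [Real.dist_eq, nuN_eq_countIn, ← hcr, div_sub' hNpos.ne', abs_div, abs_of_pos hNpos,
    div_lt_iff₀ hNpos]
  set a : ℝ := (countIn X (Finset.Ioc 0 (S k)) : ℝ)
  set b : ℝ := (countIn X (Finset.Ioc (S k) N) : ℝ)
  have hb0 : 0 ≤ b := Nat.cast_nonneg _
  have hxm : |x * (N - S k)| ≤ |x| * (S (k + 1) - S k) := by
    rw [abs_mul, abs_of_nonneg (sub_nonneg.2 hNk)]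
    have := abs_nonneg x
    gcongr
  calc |a + b - N * x| = |(a - x * S k) + b - x * (N - S k)| := by ring_nf
    _ ≤ |a - x * S k| + |b| + |x * (N - S k)| := by
        refine (abs_sub _ _).trans ?_
        gcongr
        exact abs_add_le _ _
    _ ≤ ε / 2 / 2 * S k + (S (k + 1) - S k) + |x| * (S (k + 1) - S k) := by
        rw [abs_of_nonneg hb0]
        gcongr
        linarith
    _ = ε / 2 / 2 * S k + (1 + |x|) * (S (k + 1) - S k) := by ring
    _ < ε / 2 / 2 * S k + (1 + |x|) * (ε / 2 / (1 + |x|) * S k) := by gcongr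
    _ = ε * (3 / 4) * S k := by field_simp; ring
    _ ≤ ε * N := by nlinarith

/-- A finite set can be exhausted one point at a time by initial pieces comparable, inside that
set, with all members of a given chain. -/
lemma exists_chain_filtration {C : Set (Set ℕ)} (hC : IsChain (· ⊆ ·) C) (P : Finset ℕ) :
    ∃ g : ℕ → Set ℕ, Monotone g ∧ (∀ c, g c ⊆ P) ∧ (∀ c ≤ P.card, countIn (g c) P = c) ∧
      ∀ A ∈ C, ∀ c, (∀ n ∈ P, n ∈ g c → n ∈ A) ∨ ∀ n ∈ P, n ∈ A → n ∈ g c := by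
  classical
  let r : ℕ → ℕ → Prop := fun m n =>
    (∃ A ∈ C, m ∈ A ∧ n ∉ A) ∨ ((∀ A ∈ C, m ∈ A ↔ n ∈ A) ∧ m < n)
  have hsub : ∀ A ∈ C, ∀ B ∈ C, A ⊆ B ∨ B ⊆ A := fun A hA B hB => hC.total hA hB
  have hirr : ∀ n, ¬ r n n := by
    rintro n (⟨A, -, h, h'⟩ | ⟨-, h⟩)
    · exact h' h
    · exact lt_irrefl _ h
  have htri : ∀ m n, m ≠ n → r m n ∨ r n m := by
    intro m n hmn
    by_cases h : ∀ A ∈ C, m ∈ A ↔ n ∈ A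
    · rcases hmn.lt_or_gt with h' | h'
      · exact Or.inl (Or.inr ⟨h, h'⟩)
      · exact Or.inr (Or.inr ⟨fun A hA => (h A hA).symm, h'⟩)
    · push Not at h
      obtain ⟨A, hA, ⟨h1, h2⟩ | ⟨h1, h2⟩⟩ := h
      · exact Or.inl (Or.inl ⟨A, hA, h1, h2⟩)
      · exact Or.inr (Or.inl ⟨A, hA, h2, h1⟩)
  have htrans : ∀ a b c, r a b → r b c → r a c := by
    rintro a b c (⟨A, hA, h1, h2⟩ | ⟨h1, h2⟩) (⟨B, hB, h3, h4⟩ | ⟨h3, h4⟩)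
    · left
      rcases hsub A hA B hB with h | h
      · exact ⟨B, hB, h h1, h4⟩
      · exact absurd (h h3) h2
    · exact Or.inl ⟨A, hA, h1, fun h => h2 ((h3 A hA).2 h)⟩
    · exact Or.inl ⟨B, hB, (h1 B hB).2 h3, h4⟩
    · exact Or.inr ⟨fun A hA => (h1 A hA).trans (h3 A hA), h2.trans h4⟩
  let rank : ℕ → ℕ := fun n => (P.filter (r · n)).card
  have hlt : ∀ m ∈ P, ∀ n, r m n → rank m < rank n := by
    intro m hm n hmn
    refine Finset.card_lt_card ⟨fun a ha => ?_, fun h => ?_⟩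
    · simp only [Finset.mem_filter] at ha ⊢
      exact ⟨ha.1, htrans _ _ _ ha.2 hmn⟩
    · have := h (Finset.mem_filter.2 ⟨hm, hmn⟩)
      exact hirr m (Finset.mem_filter.1 this).2
  have hinj : Set.InjOn rank P := by
    intro m hm n hn h
    by_contra hne
    rcases htri m n hne with h' | h'
    · exact (hlt m hm n h').ne h
    · exact (hlt n hn m h').ne h.symm
  have hrank : ∀ n ∈ P, rank n < P.card := fun n hn =>
    Finset.card_lt_card ⟨Finset.filter_subset _ _, fun h => hirr n (Finset.mem_filter.1 (h hn)).2⟩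
  have himage : P.image rank = Finset.range P.card :=
    Finset.eq_of_subset_of_card_le
      (fun k hk => by
        obtain ⟨n, hn, rfl⟩ := Finset.mem_image.1 hk
        exact Finset.mem_range.2 (hrank n hn))
      (by rw [Finset.card_image_of_injOn hinj, Finset.card_range])
  refine ⟨fun c => {n | n ∈ P ∧ rank n < c}, fun c d hcd n hn => ⟨hn.1, hn.2.trans_le hcd⟩,
    fun c n hn => hn.1, fun c hc => ?_, fun A hA c => ?_⟩
  · have h1 : (P.filter (rank · < c)).image rank = Finset.range c := by
      ext k
      simp only [Finset.mem_image, Finset.mem_filter, Finset.mem_range]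
      constructor
      · rintro ⟨n, ⟨-, hn⟩, rfl⟩
        exact hn
      · intro hk
        have : k ∈ P.image rank := by rw [himage]; exact Finset.mem_range.2 (hk.trans_le hc)
        obtain ⟨n, hn, rfl⟩ := Finset.mem_image.1 this
        exact ⟨n, ⟨hn, hk⟩, rfl⟩
    have h2 := congrArg Finset.card h1
    rw [Finset.card_range, Finset.card_image_of_injOn
      (hinj.mono fun n hn => (Finset.mem_filter.1 hn).1)] at h2
    rw [← h2]
    unfold countIn
    congr 1
    ext n
    simp only [Finset.mem_filter, Set.mem_ofPred_eq]
    rw [h2]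
    tauto
  · by_contra! h
    obtain ⟨⟨n, hn, hng, hnA⟩, m, hm, hmA, hmg⟩ := h
    exact hmg ⟨hm, (hlt m hm n (Or.inl ⟨A, hA, hmA, hnA⟩)).trans hng.2⟩

/-- A countable subset of `V` can approximate all other points of `V` from both sides. -/
lemma exists_countable_two_sided_dense (V : Set ℝ) :
    ∃ D ⊆ V, D.Countable ∧ ∀ t ∈ V, t ∉ D → ∀ ε > 0,
      (∃ r ∈ D, t - ε < r ∧ r < t) ∧ ∃ r ∈ D, t < r ∧ r < t + ε := by
  obtain ⟨D₀, hD₀V, hD₀, hcl⟩ :=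
    (TopologicalSpace.IsSeparable.of_separableSpace V).exists_countable_dense_subset
  refine ⟨D₀ ∪ ({x ∈ V | 𝓝[V ∩ Ioi x] x = ⊥} ∪ {x ∈ V | 𝓝[V ∩ Iio x] x = ⊥}), ?_, ?_, ?_⟩
  · exact union_subset hD₀V (union_subset (sep_subset _ _) (sep_subset _ _))
  · exact hD₀.union (countable_setOfPred_isolated_right_within.union
      countable_setOfPred_isolated_left_within)
  · intro t ht htD ε hε
    have meet : ∀ U : Set ℝ, IsOpen U → (V ∩ U).Nonempty → ∃ r ∈ D₀, r ∈ U := by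
      rintro U hU ⟨v, hv, hvU⟩
      obtain ⟨r, hrU, hr⟩ := mem_closure_iff.1 (hcl hv) U hU hvU
      exact ⟨r, hr, hrU⟩
    simp only [mem_union, mem_ofPred_eq, not_or, not_and] at htD
    obtain ⟨-, hR, hL⟩ := htD
    have hR' := mem_closure_iff.1 (mem_closure_iff_nhdsWithin_neBot.2 ⟨hR ht⟩)
      (Ioo (t - ε) (t + ε)) isOpen_Ioo ⟨by linarith, by linarith⟩
    have hL' := mem_closure_iff.1 (mem_closure_iff_nhdsWithin_neBot.2 ⟨hL ht⟩)
      (Ioo (t - ε) (t + ε)) isOpen_Ioo ⟨by linarith, by linarith⟩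
    obtain ⟨u, hu, huV, hut⟩ := hR'
    obtain ⟨w, hw, hwV, hwt⟩ := hL'
    obtain ⟨r, hr, hr'⟩ := meet (Ioo (t - ε) t) isOpen_Ioo ⟨w, hwV, hw.1, hwt⟩
    obtain ⟨s, hs, hs'⟩ := meet (Ioo t (t + ε)) isOpen_Ioo ⟨u, huV, hut, hu.2⟩
    exact ⟨⟨r, Or.inl hr, hr'.1, hr'.2⟩, s, Or.inl hs, hs'.1, hs'.2⟩

/-- A sequence tending to zero and bounded above has an antitone majorant tending to zero. -/
lemma exists_antitone_majorant {g : ℕ → ℝ} {b : ℝ} (hb : ∀ n, g n ≤ b)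
    (hg : Tendsto g atTop (𝓝 0)) :
    ∃ ε : ℕ → ℝ, Antitone ε ∧ (∀ n, g n ≤ ε n) ∧ Tendsto ε atTop (𝓝 0) := by
  have hbdd : ∀ m, BddAbove (range fun n => g (m + n)) := fun m =>
    ⟨b, by rintro _ ⟨n, rfl⟩; exact hb _⟩
  have hle : ∀ n, g n ≤ ⨆ k, g (n + k) := fun n => le_ciSup (hbdd n) 0
  refine ⟨fun m => ⨆ n, g (m + n), fun m m' h => ciSup_le fun n => ?_, hle, ?_⟩
  · have := le_ciSup (hbdd m) (m' - m + n)
    rwa [show m + (m' - m + n) = m' + n by omega] at this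
  · refine Metric.tendsto_atTop.2 fun e he => ?_
    obtain ⟨K, hK⟩ := Metric.tendsto_atTop.1 hg (e / 2) (half_pos he)
    refine ⟨K, fun m hm => ?_⟩
    have h1 : ⨆ n, g (m + n) ≤ e / 2 := ciSup_le fun n => by
      have := hK (m + n) (by omega)
      rw [Real.dist_eq, sub_zero] at this
      exact ((le_abs_self _).trans_lt this).le
    have h2 := hK m hm
    rw [Real.dist_eq, sub_zero] at h2
    rw [Real.dist_eq, sub_zero, abs_lt]
    have := neg_abs_le (g m)
    have := hle m
    constructor <;> linarith

/-- Countably many sets with densities admit a common positive antitone error rate. -/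
lemma exists_common_rate {X : ℕ → Set ℕ} {d : ℕ → ℝ} (h : ∀ i, HasDensity (X i) (d i)) :
    ∃ ε : ℕ → ℝ, Antitone ε ∧ Tendsto ε atTop (𝓝 0) ∧ (∀ n : ℕ, 1 / ((n : ℝ) + 1) ≤ ε n) ∧
      ∀ i, ∃ c : ℝ, ∀ n, |nuN (X i) n - d i| ≤ c * ε n := by
  have hδ : ∀ i n, |nuN (X i) n - d i| ≤ 1 := fun i n => by
    have := nuN_nonneg (X i) n
    have := nuN_le_one (X i) n
    have := (h i).nonneg
    have := (h i).le_one
    rw [abs_le]; constructor <;> linarith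
  have hterm : ∀ i n, (1 / 2 : ℝ) ^ i * |nuN (X i) n - d i| ≤ (1 / 2 : ℝ) ^ i := fun i n =>
    mul_le_of_le_one_right (by positivity) (hδ i n)
  have hsum : ∀ n, Summable fun i => (1 / 2 : ℝ) ^ i * |nuN (X i) n - d i| := fun n =>
    Summable.of_nonneg_of_le (fun i => by positivity) (fun i => hterm i n) summable_geometric_two
  have hT : Tendsto (fun n => ∑' i, (1 / 2 : ℝ) ^ i * |nuN (X i) n - d i|) atTop (𝓝 0) := by
    have := tendsto_tsum_of_dominated_convergence (𝓕 := atTop)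
      (f := fun n i => (1 / 2 : ℝ) ^ i * |nuN (X i) n - d i|) (g := fun _ => (0 : ℝ))
      summable_geometric_two (fun i => by
        have := (((h i).sub_const (d i)).abs).const_mul ((1 / 2 : ℝ) ^ i)
        simpa using this)
      (Eventually.of_forall fun n i => by
        rw [Real.norm_of_nonneg (by positivity)]
        exact hterm i n)
    simpa using this
  obtain ⟨ε, hε, hgε, hε0⟩ := exists_antitone_majorant
    (g := fun n : ℕ => ∑' i, (1 / 2 : ℝ) ^ i * |nuN (X i) n - d i| + 1 / ((n : ℝ) + 1)) (b := 3)
    (fun n => by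
      have h1 := (hsum n).tsum_le_tsum (fun i => hterm i n) summable_geometric_two
      rw [tsum_geometric_two] at h1
      have h2 : 1 / ((n : ℝ) + 1) ≤ 1 := by
        rw [div_le_one (by positivity)]
        have : (0 : ℝ) ≤ n := Nat.cast_nonneg n
        linarith
      linarith)
    (by simpa using hT.add tendsto_one_div_add_atTop_nhds_zero_nat)
  refine ⟨ε, hε, hε0, fun n => ?_, fun i => ⟨2 ^ i, fun n => ?_⟩⟩
  · have : 0 ≤ ∑' i, (1 / 2 : ℝ) ^ i * |nuN (X i) n - d i| := tsum_nonneg fun i => by positivity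
    have := hgε n
    linarith
  · have h1 : (1 / 2 : ℝ) ^ i * |nuN (X i) n - d i| ≤ ε n := by
      have h2 := (hsum n).le_tsum i fun j _ => by positivity
      have h3 : 0 ≤ 1 / ((n : ℝ) + 1) := by positivity
      have := hgε n
      linarith
    calc |nuN (X i) n - d i| = 2 ^ i * ((1 / 2 : ℝ) ^ i * |nuN (X i) n - d i|) := by
          rw [← mul_assoc, ← mul_pow]; norm_num
      _ ≤ 2 ^ i * ε n := by gcongr

/-- The positive integers split into consecutive blocks of growing but relatively negligible length
along which each of countably many given sets has its density. -/
lemma exists_blocks {X : ℕ → Set ℕ} {d : ℕ → ℝ} (h : ∀ i, HasDensity (X i) (d i)) :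
    ∃ S : ℕ → ℕ, StrictMono S ∧ S 0 = 0 ∧
      Tendsto (fun j => (S (j + 1) : ℝ) - S j) atTop atTop ∧
      Tendsto (fun j => ((S (j + 1) : ℝ) - S j) / S j) atTop (𝓝 0) ∧
      (∃ θ : ℕ → ℝ, Antitone θ ∧ (∀ j, θ j ≤ 1) ∧ Tendsto θ atTop (𝓝 0) ∧
        ∀ j, (S (j + 1) : ℝ) - S j ≤ θ j * S (j + 1)) ∧
      ∀ i, Tendsto (fun j => (countIn (X i) (Finset.Ioc (S j) (S (j + 1))) : ℝ) /
        ((S (j + 1) : ℝ) - S j)) atTop (𝓝 (d i)) := by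
  obtain ⟨ε, hεa, hε0, hεl, hεX⟩ := exists_common_rate h
  have hεpos : ∀ n, 0 < ε n := fun n => lt_of_lt_of_le (by positivity) (hεl n)
  set s : ℕ → ℝ := fun n => √(ε n) with hs
  have hsa : Antitone s := fun m n hmn => Real.sqrt_le_sqrt (hεa hmn)
  have hspos : ∀ n, 0 < s n := fun n => Real.sqrt_pos.2 (hεpos n)
  have hss : ∀ n, s n * s n = ε n := fun n => Real.mul_self_sqrt (hεpos n).le
  have hs0 : Tendsto s atTop (𝓝 0) := by
    have := (Real.continuous_sqrt.tendsto 0).comp hε0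
    rwa [Real.sqrt_zero] at this
  let S : ℕ → ℕ := fun j => (fun a => a + (⌊s a * a⌋₊ + 1))^[j] 0
  have hSs : ∀ j, S (j + 1) = S j + (⌊s (S j) * S j⌋₊ + 1) := fun j =>
    Function.iterate_succ_apply' _ _ _
  have hS0 : S 0 = 0 := rfl
  clear_value S
  have hSm : StrictMono S := strictMono_nat_of_lt_succ fun j => by rw [hSs]; omega
  have hL : ∀ j, (S (j + 1) : ℝ) - S j = ⌊s (S j) * S j⌋₊ + 1 := fun j => by
    rw [hSs]; push_cast; ring
  have hLl : ∀ j, s (S j) * S j ≤ (S (j + 1) : ℝ) - S j := fun j => by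
    rw [hL]; exact (Nat.lt_floor_add_one _).le
  have hLu : ∀ j, (S (j + 1) : ℝ) - S j ≤ s (S j) * S j + 1 := fun j => by
    rw [hL]
    have := Nat.floor_le (mul_nonneg (hspos (S j)).le (Nat.cast_nonneg (α := ℝ) (S j)))
    linarith
  have hLpos : ∀ j, (0 : ℝ) < (S (j + 1) : ℝ) - S j := fun j => by rw [hL]; positivity
  have hSr : Tendsto (fun n => (S n : ℝ)) atTop atTop :=
    tendsto_natCast_atTop_atTop.comp hSm.tendsto_atTop
  have hsS : Tendsto (fun j => s (S j)) atTop (𝓝 0) := hs0.comp hSm.tendsto_atTop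
  refine ⟨S, hSm, hS0, ?_, ?_, ⟨fun j => min 1 (s (S j) + 1 / S (j + 1)), ?_, ?_, ?_, ?_⟩, ?_⟩
  · have hq : Tendsto (fun j => √((S j : ℝ) + 1) - 1) atTop atTop :=
      tendsto_atTop_add_const_right _ _
        (Real.tendsto_sqrt_atTop.comp (tendsto_atTop_add_const_right _ _ hSr))
    refine tendsto_atTop_mono (fun j => le_trans ?_ (hLl j)) hq
    have hp : (0 : ℝ) < S j + 1 := by positivity
    have h1 : 1 / √((S j : ℝ) + 1) ≤ s (S j) := by
      rw [← Real.sqrt_one, ← Real.sqrt_div zero_le_one, Real.sqrt_one]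
      exact Real.sqrt_le_sqrt (hεl _)
    have h2 : √((S j : ℝ) + 1) - 1 ≤ 1 / √((S j : ℝ) + 1) * S j := by
      have h3 : 0 < √((S j : ℝ) + 1) := Real.sqrt_pos.2 hp
      have h4 : √((S j : ℝ) + 1) * √((S j : ℝ) + 1) = S j + 1 := Real.mul_self_sqrt hp.le
      have h5 : 1 ≤ √((S j : ℝ) + 1) := Real.one_le_sqrt.2 (by
        have : (0 : ℝ) ≤ S j := Nat.cast_nonneg _
        linarith)
      rw [one_div, ← div_eq_inv_mul, le_div_iff₀ h3]
      nlinarith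
    exact h2.trans (by gcongr)
  · refine squeeze_zero' (g := fun j => s (S j) + 1 / S j)
      (Eventually.of_forall fun j => div_nonneg (hLpos j).le (Nat.cast_nonneg _)) ?_ ?_
    · filter_upwards [hSr.eventually_gt_atTop 0] with j hj
      rw [div_le_iff₀ hj, add_mul, one_div_mul_cancel hj.ne']
      exact hLu j
    · simpa using hsS.add (hSr.const_div_atTop 1)
  · refine antitone_const.min fun i j hij => ?_
    have h1 : s (S j) ≤ s (S i) := hsa (hSm.monotone hij)
    have h2 : (S (i + 1) : ℝ) ≤ S (j + 1) := by
      exact_mod_cast hSm.monotone (Nat.succ_le_succ hij)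
    have h3 : (0 : ℝ) < S (i + 1) := by
      exact_mod_cast (Nat.zero_le _).trans_lt (hSm (Nat.lt_succ_self i))
    gcongr
  · exact fun j => min_le_left _ _
  · have h1 : Tendsto (fun j => s (S j) + 1 / (S (j + 1) : ℝ)) atTop (𝓝 0) := by
      simpa using hsS.add ((hSr.comp (tendsto_add_atTop_nat 1)).const_div_atTop 1)
    simpa using (tendsto_const_nhds (x := (1 : ℝ))).min h1
  · intro j
    have h3 : (0 : ℝ) < S (j + 1) := by
      exact_mod_cast (Nat.zero_le _).trans_lt (hSm (Nat.lt_succ_self j))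
    have h4 : (0 : ℝ) ≤ S j := Nat.cast_nonneg _
    rcases min_cases (1 : ℝ) (s (S j) + 1 / S (j + 1)) with ⟨h, -⟩ | ⟨h, -⟩ <;> simp only [h]
    · linarith
    · rw [add_mul, one_div_mul_cancel h3.ne']
      have := mul_le_mul_of_nonneg_left (show (S j : ℝ) ≤ S (j + 1) by
        linarith [hLpos j]) (hspos (S j)).le
      linarith [hLu j]
  · intro i
    obtain ⟨c, hc⟩ := hεX i
    have hc0 : 0 ≤ c := by
      by_contra! hneg
      have := (abs_nonneg _).trans (hc 0)
      have := mul_neg_of_neg_of_pos hneg (hεpos 0)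
      linarith
    have herr : ∀ n, |(countIn (X i) (Finset.Ioc 0 n) : ℝ) - d i * n| ≤ c * ε n * n := fun n => by
      rw [countIn_eq_nuN_mul, ← sub_mul, abs_mul, Nat.abs_cast]
      gcongr
      exact hc n
    rw [tendsto_iff_norm_sub_tendsto_zero]
    refine squeeze_zero (g := fun j => c * (2 * s (S j) + ε (S j))) (fun j => norm_nonneg _)
      (fun j => ?_) ?_
    · have hadd : (countIn (X i) (Finset.Ioc 0 (S j)) : ℝ) +
          countIn (X i) (Finset.Ioc (S j) (S (j + 1))) =
          countIn (X i) (Finset.Ioc 0 (S (j + 1))) := by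
        exact_mod_cast countIn_Ioc_add (Nat.zero_le (S j)) (hSm.monotone (Nat.le_succ j))
      have e1 := herr (S j)
      have e2 := herr (S (j + 1))
      have e3 : c * ε (S (j + 1)) * S (j + 1) ≤ c * ε (S j) * S (j + 1) := by
        have := hεa (hSm.monotone (Nat.le_succ j))
        gcongr
      have e4 : ε (S j) * S j ≤ s (S j) * ((S (j + 1) : ℝ) - S j) := by
        rw [← hss, mul_assoc]
        exact mul_le_mul_of_nonneg_left (hLl j) (hspos _).le
      have e5 := mul_le_mul_of_nonneg_left e4 hc0
      rw [Real.norm_eq_abs, div_sub' (hLpos j).ne', abs_div, abs_of_pos (hLpos j),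
        div_le_iff₀ (hLpos j)]
      rw [abs_le] at e1 e2 ⊢
      constructor <;> nlinarith
    · simpa using ((hsS.const_mul 2).add (hε0.comp hSm.tendsto_atTop)).const_mul c

/-- A member of the chain of larger density contains the one of smaller density. -/
lemma IsChain.subset_of_nu_lt {C : Set (Set ℕ)} (hC : IsChain (· ⊆ ·) C) (hF : ∀ A ∈ C, memF A)
    {A B : Set ℕ} (hA : A ∈ C) (hB : B ∈ C) (h : nu A < nu B) : A ⊆ B :=
  (hC.total hA hB).resolve_right fun h' =>
    absurd ((hF B hB).hasDensity.mono (hF A hA).hasDensity h') h.not_ge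

/-- A chain of sets with densities admits blocks, of growing but relatively negligible length, along
which at least one chain member of each occurring density has that density. -/
lemma exists_blocks_of_isChain {C : Set (Set ℕ)} (hC : IsChain (· ⊆ ·) C)
    (hF : ∀ A ∈ C, memF A) :
    ∃ S : ℕ → ℕ, StrictMono S ∧ S 0 = 0 ∧
      Tendsto (fun j => (S (j + 1) : ℝ) - S j) atTop atTop ∧
      Tendsto (fun j => ((S (j + 1) : ℝ) - S j) / S j) atTop (𝓝 0) ∧
      (∃ θ : ℕ → ℝ, Antitone θ ∧ (∀ j, θ j ≤ 1) ∧ Tendsto θ atTop (𝓝 0) ∧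
        ∀ j, (S (j + 1) : ℝ) - S j ≤ θ j * S (j + 1)) ∧
      ∀ A ∈ C, ∃ B ∈ C, nu B = nu A ∧
        Tendsto (fun j => (countIn B (Finset.Ioc (S j) (S (j + 1))) : ℝ) /
          ((S (j + 1) : ℝ) - S j)) atTop (𝓝 (nu A)) := by
  obtain ⟨D, hDV, hDc, hD⟩ := exists_countable_two_sided_dense (nu '' C)
  obtain ⟨X, hX, hXD⟩ : ∃ X : ℕ → Set ℕ, (∀ i, HasDensity (X i) (nu (X i))) ∧
      ∀ r ∈ D, ∃ i, X i ∈ C ∧ nu (X i) = r := by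
    rcases D.eq_empty_or_nonempty with rfl | hne
    · have h0 : HasDensity ∅ 0 := by simp [HasDensity, nuN]
      exact ⟨fun _ => ∅, fun _ => h0.memF.hasDensity, by simp⟩
    · obtain ⟨f, rfl⟩ := hDc.exists_eq_range hne
      choose X hXC hXf using fun i => hDV (mem_range_self i)
      exact ⟨X, fun i => (hF _ (hXC i)).hasDensity, by
        rintro _ ⟨i, rfl⟩; exact ⟨i, hXC i, hXf i⟩⟩
  obtain ⟨S, hS, h0, hL, hLS, hθ, hcount⟩ := exists_blocks hX
  refine ⟨S, hS, h0, hL, hLS, hθ, fun A hA => ?_⟩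
  by_cases hAD : nu A ∈ D
  · obtain ⟨i, hi, hiA⟩ := hXD _ hAD
    exact ⟨X i, hi, hiA, hiA ▸ hcount i⟩
  have hmono : ∀ {U V : Set ℕ}, U ⊆ V → ∀ j,
      (countIn U (Finset.Ioc (S j) (S (j + 1))) : ℝ) / ((S (j + 1) : ℝ) - S j) ≤
      (countIn V (Finset.Ioc (S j) (S (j + 1))) : ℝ) / ((S (j + 1) : ℝ) - S j) := by
    intro U V h j
    have h1 : (0 : ℝ) ≤ (S (j + 1) : ℝ) - S j := sub_nonneg.2 (by
      exact_mod_cast hS.monotone (Nat.le_succ j))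
    have h2 : countIn U (Finset.Ioc (S j) (S (j + 1))) ≤ countIn V (Finset.Ioc (S j) (S (j + 1))) :=
      countIn_mono fun n _ hn => h hn
    gcongr
  refine ⟨A, hA, rfl, tendsto_order.2 ⟨fun a ha => ?_, fun a ha => ?_⟩⟩
  · obtain ⟨r, hr, har, hrA⟩ := (hD _ (mem_image_of_mem _ hA) hAD _ (sub_pos.2 ha)).1
    obtain ⟨i, hi, rfl⟩ := hXD r hr
    rw [sub_sub_cancel] at har
    filter_upwards [(tendsto_order.1 (hcount i)).1 a har] with j hj
    exact hj.trans_le (hmono (hC.subset_of_nu_lt hF hi hA hrA) j)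
  · obtain ⟨r, hr, hAr, hra⟩ := (hD _ (mem_image_of_mem _ hA) hAD _ (sub_pos.2 ha)).2
    obtain ⟨i, hi, rfl⟩ := hXD r hr
    rw [add_sub_cancel] at hra
    filter_upwards [(tendsto_order.1 (hcount i)).2 a hra] with j hj
    exact (hmono (hC.subset_of_nu_lt hF hA hi hAr) j).trans_lt hj

/-- Up to null sets, a chain of sets with densities embeds into a chain indexed by `[0, 1]` all of
whose partial averages are bounded by the density. -/
lemma exists_density_chain {C : Set (Set ℕ)} (hC : IsChain (· ⊆ ·) C) (hF : ∀ A ∈ C, memF A) :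
    ∃ E : ℝ → Set ℕ, MonotoneOn E (Icc 0 1) ∧ (∀ t ∈ Icc (0 : ℝ) 1, HasDensity (E t) t) ∧
      (∀ t ∈ Icc (0 : ℝ) 1, ∀ N, nuN (E t) N ≤ t) ∧
      ∀ A ∈ C, HasDensity (symmDiff (E (nu A)) A) 0 := by
  obtain ⟨S, hS, h0, hL, hLS, ⟨θ, hθa, hθ1, hθ0, hθL⟩, hcount⟩ := exists_blocks_of_isChain hC hF
  have hLpos : ∀ j, (0 : ℝ) < (S (j + 1) : ℝ) - S j := fun j => by
    have : (S j : ℝ) < S (j + 1) := by exact_mod_cast hS (Nat.lt_succ_self j)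
    linarith
  have hθpos : ∀ j, 0 < θ j := fun j =>
    pos_of_mul_pos_left ((hLpos j).trans_le (hθL j)) (Nat.cast_nonneg _)
  choose g hgm hgP hgc hgA using fun j =>
    exists_chain_filtration hC (Finset.Ioc (S j) (S (j + 1)))
  let c : ℕ → ℝ → ℕ := fun j t => ⌊t * ((1 - θ j) * ((S (j + 1) : ℝ) - S j))⌋₊
  have hq : ∀ j, 0 ≤ (1 - θ j) * ((S (j + 1) : ℝ) - S j) := fun j =>
    mul_nonneg (sub_nonneg.2 (hθ1 j)) (hLpos j).le
  have hcm : ∀ j, Monotone (c j) := fun j s t hst =>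
    Nat.floor_le_floor (mul_le_mul_of_nonneg_right hst (hq j))
  have hcu : ∀ j, ∀ t ∈ Icc (0 : ℝ) 1, (c j t : ℝ) ≤ t * ((1 - θ j) * ((S (j + 1) : ℝ) - S j)) :=
    fun j t ht => Nat.floor_le (mul_nonneg ht.1 (hq j))
  have hcard : ∀ j, ∀ t ∈ Icc (0 : ℝ) 1, c j t ≤ (Finset.Ioc (S j) (S (j + 1))).card := by
    intro j t ht
    have h1 := mul_le_of_le_one_left (hq j) ht.2
    have h2 : (1 - θ j) * ((S (j + 1) : ℝ) - S j) ≤ (S (j + 1) : ℝ) - S j :=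
      mul_le_of_le_one_left (hLpos j).le (by linarith [hθpos j])
    rw [Nat.card_Ioc]
    have h3 := (hcu j t ht).trans (h1.trans h2)
    rw [← Nat.cast_sub (hS.monotone (Nat.le_succ j))] at h3
    exact_mod_cast h3
  let E : ℝ → Set ℕ := fun t => {n | ∃ j, n ∈ g j (c j t)}
  have hEg : ∀ j t, ∀ n ∈ Finset.Ioc (S j) (S (j + 1)), n ∈ E t ↔ n ∈ g j (c j t) := by
    intro j t n hn
    refine ⟨fun ⟨i, hi⟩ => ?_, fun h => ⟨j, h⟩⟩
    have hn' := hgP i _ hi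
    simp only [Finset.coe_Ioc, Set.mem_Ioc, Finset.mem_Ioc] at hn hn'
    have hij : i = j := by
      have h1 := hS.lt_iff_lt.1 (hn.1.trans_le hn'.2)
      have h2 := hS.lt_iff_lt.1 (hn'.1.trans_le hn.2)
      omega
    rwa [hij] at hi
  have hEc : ∀ j, ∀ t ∈ Icc (0 : ℝ) 1, countIn (E t) (Finset.Ioc (S j) (S (j + 1))) = c j t := by
    intro j t ht
    rw [← hgc j _ (hcard j t ht)]
    exact le_antisymm (countIn_mono fun n hn => (hEg j t n hn).1)
      (countIn_mono fun n hn => (hEg j t n hn).2)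
  have hElim : ∀ t ∈ Icc (0 : ℝ) 1,
      Tendsto (fun j => (countIn (E t) (Finset.Ioc (S j) (S (j + 1))) : ℝ) /
        ((S (j + 1) : ℝ) - S j)) atTop (𝓝 t) := by
    intro t ht
    have h1 : Tendsto (fun j => t * (1 - θ j)) atTop (𝓝 t) := by
      simpa using (hθ0.const_sub 1).const_mul t
    refine tendsto_of_tendsto_of_tendsto_of_le_of_le
      (g := fun j => t * (1 - θ j) - 1 / ((S (j + 1) : ℝ) - S j)) (h := fun j => t * (1 - θ j))
      (by simpa using h1.sub (hL.const_div_atTop 1)) h1 (fun j => ?_) (fun j => ?_)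
    · simp only [hEc j t ht]
      rw [le_div_iff₀ (hLpos j), sub_mul, one_div_mul_cancel (hLpos j).ne', mul_assoc]
      exact (Nat.sub_one_lt_floor _).le
    · simp only [hEc j t ht]
      rw [div_le_iff₀ (hLpos j), mul_assoc]
      exact hcu j t ht
  refine ⟨E, fun s _ t _ hst n ⟨j, hj⟩ => ⟨j, hgm j (hcm j hst) hj⟩,
    fun t ht => hasDensity_of_blocks hS h0 hLS (hElim t ht), fun t ht N => ?_, fun A hA => ?_⟩
  · obtain ⟨k, -, hk1, hk2⟩ := hS.exists_le_lt_succ (K := 0) (N := N) (by omega)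
    have h1 : (countIn (E t) (Finset.Ioc 0 N) : ℝ) ≤ countIn (E t) (Finset.Ioc 0 (S (k + 1))) := by
      exact_mod_cast countIn_mono_right (Finset.Ioc_subset_Ioc_right hk2.le)
    have h2 : ∑ j ∈ Finset.range (k + 1), ((S (j + 1) : ℝ) - S j) = S (k + 1) := by
      rw [Finset.sum_range_sub (fun j => (S j : ℝ)), h0]; simp
    have h3 : ∑ j ∈ Finset.range (k + 1), (1 - θ j) * ((S (j + 1) : ℝ) - S j) ≤ S k := by
      calc ∑ j ∈ Finset.range (k + 1), (1 - θ j) * ((S (j + 1) : ℝ) - S j)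
          ≤ ∑ j ∈ Finset.range (k + 1), (1 - θ k) * ((S (j + 1) : ℝ) - S j) := by
            refine Finset.sum_le_sum fun j hj => ?_
            have := hθa (Nat.lt_succ_iff.1 (Finset.mem_range.1 hj))
            exact mul_le_mul_of_nonneg_right (by linarith) (hLpos j).le
        _ = (1 - θ k) * S (k + 1) := by rw [← Finset.mul_sum, h2]
        _ ≤ S k := by linarith [hθL k]
    have h4 : (countIn (E t) (Finset.Ioc 0 (S (k + 1))) : ℝ) ≤ t * S k := by
      rw [← sum_countIn_blocks hS h0]
      calc ∑ j ∈ Finset.range (k + 1), (countIn (E t) (Finset.Ioc (S j) (S (j + 1))) : ℝ)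
          ≤ ∑ j ∈ Finset.range (k + 1), t * ((1 - θ j) * ((S (j + 1) : ℝ) - S j)) :=
            Finset.sum_le_sum fun j _ => by rw [hEc j t ht]; exact hcu j t ht
        _ ≤ t * S k := by
          rw [← Finset.mul_sum]; exact mul_le_mul_of_nonneg_left h3 ht.1
    have h5 : (S k : ℝ) ≤ N := by exact_mod_cast hk1
    rw [nuN_eq_countIn]
    refine div_le_of_le_mul₀ (Nat.cast_nonneg _) ht.1 ((h1.trans h4).trans ?_)
    exact mul_le_mul_of_nonneg_left h5 ht.1
  · obtain ⟨B, hB, hBA, hBlim⟩ := hcount A hA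
    have hAd := (hF A hA).hasDensity
    have hBd := (hF B hB).hasDensity
    have ht : nu A ∈ Icc (0 : ℝ) 1 := ⟨hAd.nonneg, hAd.le_one⟩
    have hEB : HasDensity (symmDiff (E (nu A)) B) 0 := by
      refine hasDensity_of_blocks hS h0 hLS ?_
      have h1 := ((hElim _ ht).sub hBlim).abs
      rw [sub_self, abs_zero] at h1
      refine h1.congr fun j => ?_
      rw [countIn_symmDiff, ← sub_div, abs_div, abs_of_pos (hLpos j)]
      rcases hgA j B hB (c j (nu A)) with h | h
      · exact Or.inl fun n hn hnE => h n hn ((hEg j _ n hn).1 hnE)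
      · exact Or.inr fun n hn hnB => (hEg j _ n hn).2 (h n hn hnB)
    refine hEB.zero_symmDiff_trans ?_
    rw [hBA] at hBd
    rcases hC.total hB hA with h | h
    · exact hBd.zero_symmDiff_of_subset hAd h
    · rw [symmDiff_comm]
      exact hAd.zero_symmDiff_of_subset hBd h

lemma IsChain.starClosure {T : Set (Set ℕ)} (hT : IsChain (· ⊆ ·) T) :
    IsChain (· ⊆ ·) (starClosure T) := by
  have hUU : ∀ C ⊆ T, ∀ D ⊆ T, ⋃₀ C ⊆ ⋃₀ D ∨ ⋃₀ D ⊆ ⋃₀ C := by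
    intro C hC D hD
    by_cases h : ∀ c ∈ C, ∃ d ∈ D, c ⊆ d
    · refine Or.inl (sUnion_subset fun c hc => ?_)
      obtain ⟨d, hd, hcd⟩ := h c hc
      exact hcd.trans (subset_sUnion_of_mem hd)
    · push Not at h
      obtain ⟨c, hc, h⟩ := h
      exact Or.inr (sUnion_subset fun d hd =>
        ((hT.total (hC hc) (hD hd)).resolve_left (h d hd)).trans (subset_sUnion_of_mem hc))
  have hII : ∀ C ⊆ T, ∀ D ⊆ T, ⋂₀ C ⊆ ⋂₀ D ∨ ⋂₀ D ⊆ ⋂₀ C := by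
    intro C hC D hD
    by_cases h : ∀ d ∈ D, ∃ c ∈ C, c ⊆ d
    · refine Or.inl (subset_sInter fun d hd => ?_)
      obtain ⟨c, hc, hcd⟩ := h d hd
      exact (sInter_subset_of_mem hc).trans hcd
    · push Not at h
      obtain ⟨d, hd, h⟩ := h
      exact Or.inr (subset_sInter fun c hc =>
        (sInter_subset_of_mem hd).trans ((hT.total (hC hc) (hD hd)).resolve_left (h c hc)))
  have hUI : ∀ C ⊆ T, ∀ D ⊆ T, ⋃₀ C ⊆ ⋂₀ D ∨ ⋂₀ D ⊆ ⋃₀ C := by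
    intro C hC D hD
    by_cases h : ∀ c ∈ C, ∀ d ∈ D, c ⊆ d
    · exact Or.inl (sUnion_subset fun c hc => subset_sInter fun d hd => h c hc d hd)
    · push Not at h
      obtain ⟨c, hc, d, hd, h⟩ := h
      exact Or.inr ((sInter_subset_of_mem hd).trans
        (((hT.total (hC hc) (hD hd)).resolve_left h).trans (subset_sUnion_of_mem hc)))
  rintro A (⟨C, hC, rfl⟩ | ⟨C, hC, rfl⟩) B (⟨D, hD, rfl⟩ | ⟨D, hD, rfl⟩) -
  · exact hUU C hC D hD
  · exact hUI C hC D hD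
  · exact (hUI D hD C hC).symm
  · exact hII C hC D hD

lemma hasDensity_zero_symmDiff_of_approx {U W : Set ℕ}
    (h : ∀ ε > 0, ∃ P Q : Set ℕ, ∃ b < ε, HasDensity (symmDiff U P) b ∧
      HasDensity (symmDiff P Q) 0 ∧ HasDensity (symmDiff Q W) b) :
    HasDensity (symmDiff U W) 0 := by
  refine tendsto_order.2 ⟨fun a ha => Eventually.of_forall fun N => ha.trans_le (nuN_nonneg _ N),
    fun a ha => ?_⟩
  obtain ⟨P, Q, b, hb, h1, h2, h3⟩ := h (a / 2) (half_pos ha)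
  have h4 := Tendsto.add (Tendsto.add h1 h2) h3
  filter_upwards [(tendsto_order.1 h4).2 a (by linarith)] with N hN
  have h5 : symmDiff U W ⊆ symmDiff U P ∪ symmDiff P Q ∪ symmDiff Q W :=
    (symmDiff_triangle U P W).trans ((union_subset_union_right _ (symmDiff_triangle P Q W)).trans
      (union_assoc _ _ _).ge)
  have h6 := nuN_mono h5 N
  have h7 := nuN_union_le (symmDiff U P ∪ symmDiff P Q) (symmDiff Q W) N
  have h8 := nuN_union_le (symmDiff U P) (symmDiff P Q) N
  linarith

section family

variable {E : ℝ → Set ℕ} {K : Set ℝ}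

lemma hasDensity_sUnion_image (hE : MonotoneOn E (Icc 0 1))
    (hd : ∀ t ∈ Icc (0 : ℝ) 1, HasDensity (E t) t) (hK : K ⊆ Icc 0 1) (hne : K.Nonempty) :
    HasDensity (⋃₀ (E '' K)) (sSup K) ∧ ⋃₀ (E '' K) ⊆ E (sSup K) := by
  have hbdd : BddAbove K := bddAbove_Icc.mono hK
  have hs : sSup K ∈ Icc (0 : ℝ) 1 := by
    obtain ⟨k, hk⟩ := hne
    exact ⟨(hK hk).1.trans (le_csSup hbdd hk), csSup_le ⟨k, hk⟩ fun x hx => (hK hx).2⟩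
  have hsub : ⋃₀ (E '' K) ⊆ E (sSup K) := by
    rintro n ⟨_, ⟨t, ht, rfl⟩, hn⟩
    exact hE (hK ht) hs (le_csSup hbdd ht) hn
  refine ⟨tendsto_order.2 ⟨fun a ha => ?_, fun a ha => ?_⟩, hsub⟩
  · obtain ⟨t, ht, hat⟩ := exists_lt_of_lt_csSup hne ha
    filter_upwards [(tendsto_order.1 (hd t (hK ht))).1 a hat] with N hN
    exact hN.trans_le (nuN_mono (subset_sUnion_of_mem (mem_image_of_mem E ht)) N)
  · filter_upwards [(tendsto_order.1 (hd _ hs)).2 a ha] with N hN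
    exact (nuN_mono hsub N).trans_lt hN

lemma hasDensity_sInter_image (hE : MonotoneOn E (Icc 0 1))
    (hd : ∀ t ∈ Icc (0 : ℝ) 1, HasDensity (E t) t) (hK : K ⊆ Icc 0 1) (hne : K.Nonempty) :
    HasDensity (⋂₀ (E '' K)) (sInf K) := by
  have hbdd : BddBelow K := bddBelow_Icc.mono hK
  have hs : sInf K ∈ Icc (0 : ℝ) 1 := by
    obtain ⟨k, hk⟩ := hne
    exact ⟨le_csInf ⟨k, hk⟩ fun x hx => (hK hx).1, (csInf_le hbdd hk).trans (hK hk).2⟩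
  have hsub : E (sInf K) ⊆ ⋂₀ (E '' K) := by
    rintro n hn _ ⟨t, ht, rfl⟩
    exact hE hs (hK ht) (csInf_le hbdd ht) hn
  refine tendsto_order.2 ⟨fun a ha => ?_, fun a ha => ?_⟩
  · filter_upwards [(tendsto_order.1 (hd _ hs)).1 a ha] with N hN
    exact hN.trans_le (nuN_mono hsub N)
  · obtain ⟨t, ht, hta⟩ := exists_lt_of_csInf_lt hne ha
    filter_upwards [(tendsto_order.1 (hd t (hK ht))).2 a hta] with N hN
    exact (nuN_mono (sInter_subset_of_mem (mem_image_of_mem E ht)) N).trans_lt hN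

end family

theorem stmt13 (T : Set (Set ℕ)) (hchain : IsChain (· ⊆ ·) T) (hT : ∀ A ∈ T, memF A) :
    ∃ φ : Set ℕ → Set ℕ,
      (∀ A ∈ starClosure T ∩ {X | memF X}, memF (φ A)) ∧
      (∀ A ∈ starClosure T ∩ {X | memF X}, nullSet (symmDiff (φ A) A)) ∧
      (∀ A ∈ starClosure T ∩ {X | memF X}, ∀ B ∈ starClosure T ∩ {X | memF X},
        (φ A = φ B ↔ nullSet (symmDiff A B)) ∧
        (φ A ⊂ φ B ↔ (nullSet (A \ B) ∧ ¬ nullSet (symmDiff A B)))) ∧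
      (∀ S ⊆ starClosure T ∩ {X | memF X}, S.Nonempty →
        (memF (⋃₀ (φ '' S)) ∧ nu (⋃₀ (φ '' S)) = sSup (nu '' (φ '' S))) ∧
        (memF (⋂₀ (φ '' S)) ∧ nu (⋂₀ (φ '' S)) = sInf (nu '' (φ '' S)))) ∧
      (∀ A ∈ starClosure (φ '' (starClosure T ∩ {X | memF X})),
        memF A ∧ ∀ N : ℕ, nuN A N ≤ nu A) ∧
      (∀ ρ : Set ℕ → Set ℕ,
        (∀ A ∈ starClosure T ∩ {X | memF X}, memF (ρ A) ∧ nullSet (symmDiff (ρ A) A)) →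
        ∀ S ⊆ starClosure T ∩ {X | memF X}, S.Nonempty →
          ((memF (⋃₀ (ρ '' S)) ∧ nu (⋃₀ (ρ '' S)) = sSup (nu '' (ρ '' S))) →
            nullSet (symmDiff (⋃₀ (φ '' S)) (⋃₀ (ρ '' S)))) ∧
          ((memF (⋂₀ (ρ '' S)) ∧ nu (⋂₀ (ρ '' S)) = sInf (nu '' (ρ '' S))) →
            nullSet (symmDiff (⋂₀ (φ '' S)) (⋂₀ (ρ '' S))))) := by
  set 𝒞 : Set (Set ℕ) := starClosure T ∩ {X | memF X} with h𝒞
  have hC : IsChain (· ⊆ ·) 𝒞 := hchain.starClosure.mono inter_subset_left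
  have hF : ∀ A ∈ 𝒞, memF A := fun A hA => hA.2
  have hnu : ∀ A ∈ 𝒞, nu A ∈ Icc (0 : ℝ) 1 := fun A hA =>
    ⟨(hF A hA).hasDensity.nonneg, (hF A hA).hasDensity.le_one⟩
  obtain ⟨E, hE, hEd, hEN, hEA⟩ := exists_density_chain hC hF
  have hφd : ∀ A ∈ 𝒞, HasDensity (E (nu A)) (nu A) := fun A hA => hEd _ (hnu A hA)
  have hS01 : ∀ S ⊆ 𝒞, nu '' S ⊆ Icc (0 : ℝ) 1 := by
    rintro S hS _ ⟨A, hA, rfl⟩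
    exact hnu A (hS hA)
  have himg : ∀ S : Set (Set ℕ), (fun A => E (nu A)) '' S = E '' (nu '' S) := fun S =>
    (image_image E nu S).symm
  have hnuimg : ∀ ρ : Set ℕ → Set ℕ, ∀ S ⊆ 𝒞, (∀ A ∈ 𝒞, HasDensity (ρ A) (nu A)) →
      nu '' (ρ '' S) = nu '' S := fun ρ S hS hρ => by
    rw [image_image]
    exact image_congr fun A hA => (hρ A (hS hA)).nu_eq
  have hU : ∀ S ⊆ 𝒞, S.Nonempty →
      HasDensity (⋃₀ ((fun A => E (nu A)) '' S)) (sSup (nu '' S)) := fun S hS hne => by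
    rw [himg]; exact (hasDensity_sUnion_image hE hEd (hS01 S hS) (hne.image nu)).1
  have hI : ∀ S ⊆ 𝒞, S.Nonempty →
      HasDensity (⋂₀ ((fun A => E (nu A)) '' S)) (sInf (nu '' S)) := fun S hS hne => by
    rw [himg]; exact hasDensity_sInter_image hE hEd (hS01 S hS) (hne.image nu)
  have heq : ∀ A ∈ 𝒞, ∀ B ∈ 𝒞, nullSet (symmDiff A B) ↔ nu A = nu B := by
    intro A hA B hB
    have hAd := (hF A hA).hasDensity
    have hBd := (hF B hB).hasDensity
    rw [nullSet_iff]
    refine ⟨fun h => (hAd.congr_symmDiff h).nu_eq.symm, fun h => ?_⟩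
    rw [h] at hAd
    rcases hC.total hA hB with h' | h'
    · exact hAd.zero_symmDiff_of_subset hBd h'
    · rw [symmDiff_comm]
      exact hBd.zero_symmDiff_of_subset hAd h'
  have hlt : ∀ A ∈ 𝒞, ∀ B ∈ 𝒞,
      (nullSet (A \ B) ∧ ¬ nullSet (symmDiff A B)) ↔ nu A < nu B := by
    intro A hA B hB
    have hAd := (hF A hA).hasDensity
    have hBd := (hF B hB).hasDensity
    rw [heq A hA B hB, nullSet_iff]
    constructor
    · rintro ⟨h, hne⟩
      refine lt_of_le_of_ne ?_ hne
      rcases hC.total hA hB with h' | h'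
      · exact hAd.mono hBd h'
      · have := (hBd.sdiff hAd h').nu_eq.symm.trans h.nu_eq
        linarith
    · intro h
      refine ⟨?_, h.ne⟩
      rw [Set.sdiff_eq_empty.2 (hC.subset_of_nu_lt hF hA hB h)]
      simp [HasDensity, nuN]
  refine ⟨fun A => E (nu A), fun A hA => (hφd A hA).memF, fun A hA => nullSet_iff.2 (hEA A hA),
    fun A hA B hB => ⟨?_, ?_⟩, fun S hS hne => ⟨⟨(hU S hS hne).memF, ?_⟩,
      ⟨(hI S hS hne).memF, ?_⟩⟩, ?_, fun ρ hρ S hS hne => ?_⟩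
  · rw [heq A hA B hB]
    refine ⟨fun h => ?_, fun h => by simp only [h]⟩
    have h1 := (hφd A hA).nu_eq
    simp only at h
    rw [h, (hφd B hB).nu_eq] at h1
    exact h1.symm
  · rw [hlt A hA B hB]
    constructor
    · intro h
      refine lt_of_le_of_ne ((hφd A hA).mono (hφd B hB) h.subset) fun h' => ?_
      simp only [h'] at h
      exact h.ne rfl
    · intro h
      refine (hE (hnu A hA) (hnu B hB) h.le).ssubset_of_ne fun h' => ?_
      have h1 := (hφd A hA).nu_eq
      rw [h', (hφd B hB).nu_eq] at h1
      exact h.ne h1.symm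
  · rw [hnuimg _ S hS hφd, (hU S hS hne).nu_eq]
  · rw [hnuimg _ S hS hφd, (hI S hS hne).nu_eq]
  · have of_density : ∀ {A : Set ℕ} {d : ℝ}, HasDensity A d → (∀ N, nuN A N ≤ d) →
        memF A ∧ ∀ N, nuN A N ≤ nu A := fun h h' => ⟨h.memF, h.nu_eq.symm ▸ h'⟩
    rintro A (⟨R, hR, rfl⟩ | ⟨R, hR, rfl⟩) <;>
      obtain ⟨S, hS, rfl⟩ := subset_image_iff.1 hR <;>
      rcases S.eq_empty_or_nonempty with rfl | hne
    · have h0 : HasDensity ∅ 0 := by simp [HasDensity, nuN]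
      rw [image_empty, sUnion_empty]
      exact of_density h0 fun N => by simp [nuN]
    · refine of_density (hU S hS hne) fun N => ?_
      rw [himg]
      have hsup : sSup (nu '' S) ∈ Icc (0 : ℝ) 1 :=
        ⟨(hU S hS hne).nonneg, (hU S hS hne).le_one⟩
      exact (nuN_mono (hasDensity_sUnion_image hE hEd (hS01 S hS) (hne.image nu)).2 N).trans
        (hEN _ hsup N)
    · have h1 : HasDensity univ 1 := by
        refine tendsto_const_nhds.congr' ?_
        filter_upwards [eventually_ne_atTop 0] with N hN
        have : (N : ℝ) ≠ 0 := Nat.cast_ne_zero.2 hN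
        simp [nuN, this]
      rw [image_empty, sInter_empty]
      exact of_density h1 (nuN_le_one _)
    · refine of_density (hI S hS hne) fun N => le_csInf (hne.image nu) ?_
      rintro _ ⟨A, hA, rfl⟩
      exact (nuN_mono (sInter_subset_of_mem (mem_image_of_mem _ hA)) N).trans
        (hEN _ (hnu A (hS hA)) N)
  · have hφρ : ∀ A ∈ 𝒞, HasDensity (symmDiff (E (nu A)) (ρ A)) 0 := fun A hA => by
      have h := nullSet_iff.1 (hρ A hA).2
      rw [symmDiff_comm] at h
      exact (hEA A hA).zero_symmDiff_trans h
    have hρd : ∀ A ∈ 𝒞, HasDensity (ρ A) (nu A) := fun A hA =>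
      (hφd A hA).congr_symmDiff (hφρ A hA)
    rw [hnuimg ρ S hS hρd]
    refine ⟨fun ⟨hm, hv⟩ => nullSet_iff.2 ?_, fun ⟨hm, hv⟩ => nullSet_iff.2 ?_⟩ <;>
      refine hasDensity_zero_symmDiff_of_approx fun ε hε => ?_ <;>
      have hW := hm.hasDensity <;> rw [hv] at hW
    · obtain ⟨_, ⟨A, hA, rfl⟩, hlt⟩ := exists_lt_of_lt_csSup (hne.image nu) (sub_lt_self _ hε)
      refine ⟨E (nu A), ρ A, sSup (nu '' S) - nu A, by linarith, ?_, hφρ A (hS hA),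
        (hρd A (hS hA)).symmDiff_of_subset hW (subset_sUnion_of_mem (mem_image_of_mem ρ hA))⟩
      rw [symmDiff_comm]
      exact (hφd A (hS hA)).symmDiff_of_subset (hU S hS hne)
        (subset_sUnion_of_mem (mem_image_of_mem (fun A => E (nu A)) hA))
    · obtain ⟨_, ⟨A, hA, rfl⟩, hlt⟩ := exists_lt_of_csInf_lt (hne.image nu) (lt_add_of_pos_right _ hε)
      refine ⟨E (nu A), ρ A, nu A - sInf (nu '' S), by linarith,
        (hI S hS hne).symmDiff_of_subset (hφd A (hS hA))
          (sInter_subset_of_mem (mem_image_of_mem (fun A => E (nu A)) hA)), hφρ A (hS hA), ?_⟩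
      rw [symmDiff_comm]
      exact hW.symmDiff_of_subset (hρd A (hS hA)) (sInter_subset_of_mem (mem_image_of_mem ρ hA))
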